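/- arXiv:1403.7956 — 2 statements merged into one kernel-verified Lean document; each statement's English description precedes it below -/
import Mathlib

section
/- For every integer n ≥ 2, any packing of n horocycles in the hyperbolic plane has at most 2n − 3 tangencies. Concretely: if c : Fin n → ℝ² and r : Fin n → ℝ satisfy 0 < r i < 1, ‖c i‖ = 1 − r i for all i, and ‖c i − c j‖ ≥ r i + r j for all i ≠ j, then the number of unordered pairs {i, j} with i ≠ j and ‖c i − c j‖ = r i + r j is at most 2n − 3. -/
/-- Counting lemma: if a vertex minimizing `h` has at most two neighbours in every subset. -/
theorem horo_count {n : ℕ} (h : Fin n → ℝ) (T : Fin n → Fin n → Prop)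
    (hsymm : ∀ i j, T i j → T j i)
    (h3 : ∀ i j k l, j ≠ i → k ≠ i → l ≠ i → j ≠ k → j ≠ l → k ≠ l →
      h i ≤ h j → h i ≤ h k → h i ≤ h l → T i j → T i k → T i l → False) :
    ∀ (m : ℕ) (S : Finset (Fin n)), S.card = m →
      Set.ncard {p : Fin n × Fin n | p.1 ∈ S ∧ p.2 ∈ S ∧ p.1 < p.2 ∧ T p.1 p.2} ≤ 2 * m - 3 := by
  classical
  intro m
  induction m with
  | zero =>
    intro S hS
    rw [Finset.card_eq_zero] at hS
    subst hS
    simp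
  | succ m ih =>
    intro S hS
    have hne : S.Nonempty := by
      rw [← Finset.card_pos]; omega
    obtain ⟨i, hi, hmin⟩ := Finset.exists_min_image S h hne
    have hS' : (S.erase i).card = m := by
      rw [Finset.card_erase_of_mem hi]; omega
    have hE := ih (S.erase i) hS'
    set N := (S.erase i).filter (fun k => T i k) with hN
    have hN1 : N.card ≤ m := by
      rw [← hS']; exact Finset.card_filter_le _ _
    have hN2 : N.card ≤ 2 := by
      by_contra hcon
      push Not at hcon
      obtain ⟨a, ha, b, hb, c, hc, hab, hac, hbc⟩ := Finset.two_lt_card.1 hcon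
      simp only [hN, Finset.mem_filter, Finset.mem_erase] at ha hb hc
      exact h3 i a b c ha.1.1 hb.1.1 hc.1.1 hab hac hbc (hmin a ha.1.2) (hmin b hb.1.2)
        (hmin c hc.1.2) ha.2 hb.2 hc.2
    have hsub : {p : Fin n × Fin n | p.1 ∈ S ∧ p.2 ∈ S ∧ p.1 < p.2 ∧ T p.1 p.2} ⊆
        {p : Fin n × Fin n | p.1 ∈ S.erase i ∧ p.2 ∈ S.erase i ∧ p.1 < p.2 ∧ T p.1 p.2} ∪
        ((N.image (fun k => (min i k, max i k)) : Finset (Fin n × Fin n)) :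
          Set (Fin n × Fin n)) := by
      rintro ⟨a, b⟩ ⟨ha, hb, hab, hT⟩
      simp only at ha hb hab hT
      by_cases hai : a = i
      · right
        subst hai
        simp only [Finset.coe_image, Set.mem_image, Finset.mem_coe]
        refine ⟨b, ?_, ?_⟩
        · simp [hN, hb, hT, hab.ne']
        · simp [hab.le]
      · by_cases hbi : b = i
        · right
          subst hbi
          simp only [Finset.coe_image, Set.mem_image, Finset.mem_coe]
          refine ⟨a, ?_, ?_⟩
          · simp [hN, ha, hsymm _ _ hT, hab.ne]
          · simp [hab.le]
        · left
          simp [ha, hb, hab, hT, hai, hbi]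
    have h1 := Set.ncard_le_ncard hsub (Set.toFinite _)
    have h2 := Set.ncard_union_le
      {p : Fin n × Fin n | p.1 ∈ S.erase i ∧ p.2 ∈ S.erase i ∧ p.1 < p.2 ∧ T p.1 p.2}
      ((N.image (fun k => (min i k, max i k)) : Finset (Fin n × Fin n)) : Set (Fin n × Fin n))
    rw [Set.ncard_coe_finset] at h2
    have h4 : (N.image (fun k => (min i k, max i k))).card ≤ N.card := Finset.card_image_le
    omega

/-- Two points whose mutual distance dominates their distances to a third point of the circle
lie on strictly opposite sides of the diameter through that third point. -/
theorem horo_opp_aux (p q s t : ℝ) (hs : s ^ 2 = 1 - p ^ 2) (ht : t ^ 2 = 1 - q ^ 2)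
    (hq : q < 1) (hpq : p ≤ q) (hgp : p * q + s * t ≤ p) : s * t < 0 := by
  by_contra hcon
  push Not at hcon
  have h1 : s * t ≤ p * (1 - q) := by linarith
  have hp0 : 0 ≤ p := by
    by_contra hp
    push Not at hp
    nlinarith
  have h2 : (s * t) ^ 2 ≤ (p * (1 - q)) ^ 2 := by gcongr
  rw [mul_pow, hs, ht] at h2
  have h3 : (1 - q) * ((1 - p ^ 2) * (1 + q)) ≤ (1 - q) * (p ^ 2 * (1 - q)) := by nlinarith
  have h4 := le_of_mul_le_mul_left h3 (by linarith)
  nlinarith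

theorem horo_opp (p q s t : ℝ) (hs : s ^ 2 = 1 - p ^ 2) (ht : t ^ 2 = 1 - q ^ 2)
    (hp : p < 1) (hq : q < 1) (hgp : p * q + s * t ≤ p) (hgq : p * q + s * t ≤ q) :
    s * t < 0 := by
  rcases le_total p q with h | h
  · exact horo_opp_aux p q s t hs ht hq h hgp
  · have := horo_opp_aux q p t s ht hs hp h (by linarith)
    linarith

/-- Any packing of `n ≥ 2` horocycles in the disk model of the
hyperbolic plane has at most `2n - 3` tangencies. -/
theorem horocycle_packing_tangencies_le (n : ℕ) (hn : 2 ≤ n)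
    (c : Fin n → EuclideanSpace ℝ (Fin 2)) (r : Fin n → ℝ)
    (hr0 : ∀ i, 0 < r i) (hr1 : ∀ i, r i < 1)
    (hc : ∀ i, ‖c i‖ = 1 - r i)
    (hsep : ∀ i j, i ≠ j → r i + r j ≤ ‖c i - c j‖) :
    Set.ncard {p : Fin n × Fin n | p.1 < p.2 ∧ ‖c p.1 - c p.2‖ = r p.1 + r p.2}
      ≤ 2 * n - 3 := by
  have hd : ∀ i, 0 < 1 - r i := fun i => by linarith [hr1 i]
  set h : Fin n → ℝ := fun i => r i / (1 - r i) with hh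
  set x : Fin n → ℝ := fun i => c i 0 / (1 - r i) with hx
  set y : Fin n → ℝ := fun i => c i 1 / (1 - r i) with hy
  have hhpos : ∀ i, 0 < h i := fun i => div_pos (hr0 i) (hd i)
  have er : ∀ i, r i = (1 - r i) * h i := fun i => by
    have := (hd i).ne'
    simp only [hh]; field_simp
  have ex : ∀ i, c i 0 = (1 - r i) * x i := fun i => by
    have := (hd i).ne'
    simp only [hx]; field_simp
  have ey : ∀ i, c i 1 = (1 - r i) * y i := fun i => by
    have := (hd i).ne'
    simp only [hy]; field_simp
  have hu : ∀ i, x i ^ 2 + y i ^ 2 = 1 := fun i => by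
    have h1 : (c i 0) ^ 2 + (c i 1) ^ 2 = (1 - r i) ^ 2 := by
      rw [← hc i, EuclideanSpace.norm_sq_eq]; simp
    rw [ex, ey] at h1
    have := (hd i).ne'
    have h2 : (1 - r i) ^ 2 * (x i ^ 2 + y i ^ 2) = (1 - r i) ^ 2 * 1 := by linarith
    exact mul_left_cancel₀ (pow_ne_zero 2 this) h2
  have key : ∀ i j, ‖c i - c j‖ ^ 2 - (r i + r j) ^ 2
      = 2 * ((1 - r i) * (1 - r j)) * (1 - (x i * x j + y i * y j) - 2 * (h i * h j)) := by
    intro i j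
    have h1 : ‖c i - c j‖ ^ 2 = (c i 0 - c j 0) ^ 2 + (c i 1 - c j 1) ^ 2 := by
      rw [EuclideanSpace.norm_sq_eq]; simp
    rw [h1, ex, ey, ex, ey]
    have e1 : r i * r j = ((1 - r i) * h i) * ((1 - r j) * h j) := by rw [← er, ← er]
    linear_combination (1 - r i) ^ 2 * hu i + (1 - r j) ^ 2 * hu j - 4 * e1
  have hle : ∀ i j, i ≠ j → x i * x j + y i * y j ≤ 1 - 2 * (h i * h j) := by
    intro i j hij
    have h1 := hsep i j hij
    have h2 : (r i + r j) ^ 2 ≤ ‖c i - c j‖ ^ 2 := by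
      have := hr0 i; have := hr0 j
      gcongr
    have h3 := key i j
    have h4 : 0 < 2 * ((1 - r i) * (1 - r j)) := by
      have := hd i; have := hd j; positivity
    have h5 : 0 ≤ 2 * ((1 - r i) * (1 - r j)) *
      (1 - (x i * x j + y i * y j) - 2 * (h i * h j)) := by linarith
    have := nonneg_of_mul_nonneg_right h5 h4
    linarith
  have heq : ∀ i j, ‖c i - c j‖ = r i + r j →
      x i * x j + y i * y j = 1 - 2 * (h i * h j) := by
    intro i j hij
    have h3 := key i j
    have h4 : 2 * ((1 - r i) * (1 - r j)) ≠ 0 := by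
      have := hd i; have := hd j; positivity
    rw [hij, sub_self] at h3
    have := (mul_eq_zero.1 h3.symm).resolve_left h4
    linarith
  have opp : ∀ i j k, j ≠ k → h i ≤ h j → h i ≤ h k →
      ‖c i - c j‖ = r i + r j → ‖c i - c k‖ = r i + r k →
      (x i * y j - y i * x j) * (x i * y k - y i * x k) < 0 := by
    intro i j k hjk hj hk tj tk
    have e1 := heq i j tj
    have e2 := heq i k tk
    have e3 := hle j k hjk
    have pi := hhpos i
    have pj := hhpos j
    have pk := hhpos k
    have id1 : (x i * x j + y i * y j) * (x i * x k + y i * y k)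
        + (x i * y j - y i * x j) * (x i * y k - y i * x k) = x j * x k + y j * y k := by
      linear_combination (x j * x k + y j * y k) * hu i
    apply horo_opp (x i * x j + y i * y j) (x i * x k + y i * y k)
    · linear_combination (x j ^ 2 + y j ^ 2) * hu i + hu j
    · linear_combination (x k ^ 2 + y k ^ 2) * hu i + hu k
    · have := mul_pos pi pj; linarith
    · have := mul_pos pi pk; linarith
    · rw [id1, e1]
      have : h i * h j ≤ h j * h k := by nlinarith
      linarith
    · rw [id1, e2]
      have : h i * h k ≤ h j * h k := by nlinarith
      linarith
  have main := horo_count h (fun i j => ‖c i - c j‖ = r i + r j)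
    (fun i j hij => by
      rw [norm_sub_rev, hij, add_comm])
    (by
      intro i j k l _ _ _ hjk hjl hkl hj hk hl tj tk tl
      have a1 := opp i j k hjk hj hk tj tk
      have a2 := opp i j l hjl hj hl tj tl
      have a3 := opp i k l hkl hk hl tk tl
      have a4 := mul_pos_of_neg_of_neg a1 a2
      have a5 := mul_neg_of_pos_of_neg a4 a3
      nlinarith [sq_nonneg ((x i * y j - y i * x j) * (x i * y k - y i * x k)
        * (x i * y l - y i * x l))])
    n Finset.univ (by simp)
  simpa using main
end

section
/- For n ≥ 1 let m_max(n) be the maximum, over all packings of n horospheres (families p : Fin n → ℝ², R : Fin n → ℝ with R i > 0, pairwise distinct pairs (p i, R i), and ‖p i − p j‖² ≥ 4 (R i)(R j) for i ≠ j), of the number of unordered pairs {i, j} with ‖p i − p j‖² = 4 (R i)(R j). Then 4 ≤ limsup_{n → ∞} m_max(n)/n ≤ 5. -/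
/-- The maximum number of tangencies of a packing of `n` horospheres in the
half-space model (horospheres are represented by `(p i, R i)` with `R i > 0`;
tangency of `i` and `j` means `‖p i - p j‖² = 4 R i R j`). -/
noncomputable def maxTangencies (n : ℕ) : ℕ :=
  sSup {m : ℕ | ∃ (p : Fin n → EuclideanSpace ℝ (Fin 2)) (R : Fin n → ℝ),
    (∀ i, 0 < R i) ∧
    Function.Injective (fun i => (p i, R i)) ∧
    (∀ i j, i ≠ j → 4 * R i * R j ≤ ‖p i - p j‖ ^ 2) ∧
    Set.ncard {q : Fin n × Fin n | q.1 < q.2 ∧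
      ‖p q.1 - p q.2‖ ^ 2 = 4 * R q.1 * R q.2} = m}


namespace HoroPack

lemma key_le (A B s : ℝ) (hs : 0 < s) (hA : s ≤ A) (hB : s ≤ B) :
    s ^ 2 * (A ^ 2 - A * B + B ^ 2) ≤ A ^ 2 * B ^ 2 := by
  wlog h : B ≤ A generalizing A B
  · have := this B A hB hA (by linarith)
    nlinarith
  have h1 : s ^ 2 * (A ^ 2 - A * B + B ^ 2) ≤ B ^ 2 * (A ^ 2 - A * B + B ^ 2) := by
    apply mul_le_mul_of_nonneg_right
    · gcongr
    · nlinarith [sq_nonneg (A - B), mul_pos (hs.trans_le hA) (hs.trans_le hB)]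
  have h2 : 0 ≤ B ^ 2 * (B * (A - B)) := by
    have : 0 ≤ A - B := by linarith
    have : 0 < B := by linarith
    positivity
  nlinarith

lemma key_lt (A B s : ℝ) (hs : 0 < s) (hA : s < A) (hB : s ≤ B) :
    s ^ 2 * (A ^ 2 - A * B + B ^ 2) < A ^ 2 * B ^ 2 := by
  have hBp : 0 < B := by linarith
  have hq : 0 < A ^ 2 - A * B + B ^ 2 := by
    nlinarith [sq_nonneg (A - B), mul_pos (hs.trans hA) hBp]
  rcases hB.eq_or_lt with h | h
  · subst h
    have : 0 < s ^ 3 * (A - s) := by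
      have : 0 < A - s := by linarith
      positivity
    nlinarith
  · obtain ⟨t, h1, h2⟩ := exists_between (lt_min hA h)
    have h3 := key_le A B t (by linarith) (h2.le.trans (min_le_left _ _)) (h2.le.trans (min_le_right _ _))
    have : s ^ 2 < t ^ 2 := by gcongr
    nlinarith

lemma norm_sub_sq_arg (u w : ℂ) :
    ‖u - w‖ ^ 2 = ‖u‖ ^ 2 + ‖w‖ ^ 2 - 2 * (‖u‖ * ‖w‖ * Real.cos (u.arg - w.arg)) := by
  rw [Real.cos_sub]
  have h1 := Complex.norm_mul_cos_arg u
  have h2 := Complex.norm_mul_cos_arg w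
  have h3 := Complex.norm_mul_sin_arg u
  have h4 := Complex.norm_mul_sin_arg w
  have : ‖u‖ * ‖w‖ * (Real.cos u.arg * Real.cos w.arg + Real.sin u.arg * Real.sin w.arg)
      = u.re * w.re + u.im * w.im := by
    rw [← h1, ← h2, ← h3, ← h4]; ring
  rw [this]
  simp only [← Complex.normSq_eq_norm_sq, Complex.normSq_apply, Complex.sub_re, Complex.sub_im]
  ring

lemma cos_bound (u w c : ℂ) (r a b : ℝ) (hr : 0 < r) (ha : r ≤ a) (hb : r ≤ b) (hc : c ≠ 0)
    (hu : ‖u‖ ^ 2 = 4 * r * a) (hw : ‖w‖ ^ 2 = 4 * r * b)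
    (huw : 4 * a * b ≤ ‖u - w‖ ^ 2) :
    Real.cos ((u * c).arg - (w * c).arg) ≤ 1 / 2 ∧
    (r < a → Real.cos ((u * c).arg - (w * c).arg) < 1 / 2) := by
  have h := norm_sub_sq_arg (u * c) (w * c)
  rw [← sub_mul, norm_mul, norm_mul, norm_mul] at h
  set x := Real.cos ((u * c).arg - (w * c).arg)
  have hc' : 0 < ‖c‖ := norm_pos_iff.mpr hc
  have h' : ‖u - w‖ ^ 2 = ‖u‖ ^ 2 + ‖w‖ ^ 2 - 2 * (‖u‖ * ‖w‖ * x) := by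
    have : ‖c‖ ^ 2 ≠ 0 := by positivity
    apply mul_right_cancel₀ this
    linarith
  set A := ‖u‖
  set B := ‖w‖
  have hA : 2 * r ≤ A := by
    apply le_of_sq_le_sq _ (norm_nonneg u)
    nlinarith
  have hB : 2 * r ≤ B := by
    apply le_of_sq_le_sq _ (norm_nonneg w)
    nlinarith
  have hAB : 0 < A * B := mul_pos (by linarith) (by linarith)
  have hk : (2 * r) ^ 2 * (A ^ 2 - 2 * (A * B * x) + B ^ 2) ≥ A ^ 2 * B ^ 2 := by
    have : A ^ 2 * B ^ 2 = (2 * r) ^ 2 * (4 * a * b) := by rw [hu, hw]; ring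
    rw [this]
    apply mul_le_mul_of_nonneg_left _ (by positivity)
    linarith
  have hrr : 0 < (2 * r) ^ 2 * (A * B) := by positivity
  constructor
  · have := key_le A B (2 * r) (by linarith) hA hB
    by_contra hx
    push Not at hx
    nlinarith
  · intro hlt
    have hA : 2 * r < A := by
      apply lt_of_pow_lt_pow_left₀ 2 (norm_nonneg u)
      nlinarith
    have := key_lt A B (2 * r) (by linarith) hA hB
    by_contra hx
    push Not at hx
    nlinarith

lemma half_lt_cos {t : ℝ} (h : |t| < Real.pi / 3) : 1 / 2 < Real.cos t := by
  rw [← Real.cos_abs, ← Real.cos_pi_div_three]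
  apply Real.cos_lt_cos_of_nonneg_of_le_pi (abs_nonneg t) _ h
  linarith [Real.pi_pos]

lemma half_le_cos {t : ℝ} (h : |t| ≤ Real.pi / 3) : 1 / 2 ≤ Real.cos t := by
  rw [← Real.cos_abs, ← Real.cos_pi_div_three]
  apply Real.cos_le_cos_of_nonneg_of_le_pi (abs_nonneg t) _ h
  linarith [Real.pi_pos]

noncomputable def sec (t : ℝ) : ℤ := ⌈3 * t / Real.pi⌉

lemma sec_eq_iff (t : ℝ) (k : ℤ) :
    sec t = k ↔ (k - 1) * (Real.pi / 3) < t ∧ t ≤ k * (Real.pi / 3) := by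
  have := Real.pi_pos
  rw [sec, Int.ceil_eq_iff, lt_div_iff₀ this, div_le_iff₀ this]
  constructor <;> rintro ⟨h1, h2⟩ <;> constructor <;> linarith

lemma sec_close {s t : ℝ} (h : sec s = sec t) : |s - t| < Real.pi / 3 := by
  obtain ⟨h1, h2⟩ := (sec_eq_iff s _).1 h
  obtain ⟨h3, h4⟩ := (sec_eq_iff t _).1 rfl
  rw [abs_lt]; constructor <;> linarith

lemma sec_mem {t : ℝ} (h1 : -Real.pi < t) (h2 : t ≤ Real.pi) : -2 ≤ sec t ∧ sec t ≤ 3 := by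
  have := Real.pi_pos
  constructor
  · rw [sec, ← Int.sub_one_lt_iff, Int.lt_ceil, lt_div_iff₀ this]
    push_cast; linarith
  · rw [sec, Int.ceil_le, div_le_iff₀ this]
    push_cast; linarith

lemma card_nbrs {ι : Type*} [DecidableEq ι] (T : Finset ι) (w : ι → ℂ) (R : ι → ℝ) (r : ℝ)
    (hr : 0 < r) (hR : ∀ j ∈ T, r ≤ R j) (hx : ∀ j ∈ T, R j = r → 0 ≤ (w j).re)
    (hw : ∀ j ∈ T, ‖w j‖ ^ 2 = 4 * r * R j)
    (hd : ∀ j ∈ T, ∀ k ∈ T, j ≠ k → 4 * R j * R k ≤ ‖w j - w k‖ ^ 2) : T.card ≤ 5 := by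
  have inj : ∀ c : ℂ, c ≠ 0 → Set.InjOn (fun j => sec (w j * c).arg) T := by
    intro c hc j hj k hk hjk
    by_contra hne
    have := (cos_bound (w j) (w k) c r _ _ hr (hR j hj) (hR k hk) hc (hw j hj) (hw k hk)
      (hd j hj k hk hne)).1
    linarith [half_lt_cos (sec_close hjk)]
  by_cases hv : ∃ v ∈ T, r < R v
  · obtain ⟨v, hvT, hvr⟩ := hv
    have hv0 : w v ≠ 0 := by
      intro h
      have := hw v hvT
      rw [h] at this
      simp at this
      rcases this with h | h <;> linarith
    have hm : Set.MapsTo (fun j => sec (w j * (w v)⁻¹).arg) T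
        (({-2, -1, 0, 2, 3} : Finset ℤ) : Set ℤ) := by
      intro j hj
      by_cases hjv : j = v
      · subst hjv
        simp [hv0, sec]
      · have := (cos_bound (w v) (w j) (w v)⁻¹ r _ _ hr (hR v hvT) (hR j hj) (inv_ne_zero hv0)
          (hw v hvT) (hw j hj) (hd v hvT j hj (Ne.symm hjv))).2 hvr
        rw [mul_inv_cancel₀ hv0] at this
        simp only [Complex.arg_one, zero_sub, Real.cos_neg] at this
        have hs := sec_mem (Complex.neg_pi_lt_arg (w j * (w v)⁻¹)) (Complex.arg_le_pi _)
        have h0 : sec (w j * (w v)⁻¹).arg ≠ 1 := by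
          intro h
          obtain ⟨h1, h2⟩ := (sec_eq_iff _ _).1 h
          push_cast at h1 h2
          have := half_le_cos (t := (w j * (w v)⁻¹).arg) (by rw [abs_le]; constructor <;> linarith [Real.pi_pos])
          linarith
        simp only [Finset.coe_insert, Finset.coe_singleton, Set.mem_insert_iff,
          Set.mem_singleton_iff]
        omega
    simpa using Finset.card_le_card_of_injOn _ hm (inj _ (inv_ne_zero hv0))
  · push Not at hv
    have hm : Set.MapsTo (fun j => sec (w j * 1).arg) T
        ((Finset.Icc (-1) 2 : Finset ℤ) : Set ℤ) := by
      intro j hj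
      have := hx j hj (le_antisymm (hv j hj) (hR j hj))
      have h := Complex.abs_arg_le_pi_div_two_iff.2 this
      rw [abs_le] at h
      have hp := Real.pi_pos
      simp only [mul_one, Finset.coe_Icc, Set.mem_Icc]
      constructor
      · rw [sec, ← Int.sub_one_lt_iff, Int.lt_ceil, lt_div_iff₀ hp]
        push_cast; linarith
      · rw [sec, Int.ceil_le, div_le_iff₀ hp]
        push_cast; linarith
    have := Finset.card_le_card_of_injOn _ hm (inj 1 one_ne_zero)
    simp at this
    omega

open Classical in
lemma card_edges {ι : Type*} [LinearOrder ι] (z : ι → ℂ) (R : ι → ℝ) (hR : ∀ i, 0 < R i)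
    (hd : ∀ i j, i ≠ j → 4 * R i * R j ≤ ‖z i - z j‖ ^ 2) (n : ℕ) :
    ∀ S : Finset ι, S.card = n →
    ((S ×ˢ S).filter (fun q => q.1 < q.2 ∧ ‖z q.1 - z q.2‖ ^ 2 = 4 * R q.1 * R q.2)).card
      ≤ 5 * n := by
  induction n with
  | zero => intro S hS; rw [Finset.card_eq_zero] at hS; simp [hS]
  | succ n ih =>
    intro S hS
    have hne : S.Nonempty := by rw [← Finset.card_pos]; omega
    obtain ⟨i, hi, hmin⟩ := Finset.exists_min_image S (fun i => toLex (R i, (z i).re)) hne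
    have hE := ih (S.erase i) (by rw [Finset.card_erase_of_mem hi]; omega)
    set T := (S.erase i).filter (fun j => ‖z j - z i‖ ^ 2 = 4 * R i * R j) with hT
    have hTc : T.card ≤ 5 := by
      apply card_nbrs T (fun j => z j - z i) R (R i) (hR i)
      · intro j hj
        simp only [hT, Finset.mem_filter, Finset.mem_erase] at hj
        have := hmin j hj.1.2
        rw [Prod.Lex.toLex_le_toLex] at this
        rcases this with h | h
        · exact h.le
        · exact h.1.le
      · intro j hj hj2
        simp only [hT, Finset.mem_filter, Finset.mem_erase] at hj
        have := hmin j hj.1.2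
        rw [Prod.Lex.toLex_le_toLex] at this
        rcases this with h | h
        · simp only at h; linarith
        · simpa using h.2
      · intro j hj
        simp only [hT, Finset.mem_filter, Finset.mem_erase] at hj
        exact hj.2
      · intro j _ k _ hjk
        simpa using hd j k hjk
    have hsub : (S ×ˢ S).filter (fun q => q.1 < q.2 ∧ ‖z q.1 - z q.2‖ ^ 2 = 4 * R q.1 * R q.2)
      ⊆ ((S.erase i ×ˢ S.erase i).filter
          (fun q => q.1 < q.2 ∧ ‖z q.1 - z q.2‖ ^ 2 = 4 * R q.1 * R q.2)) ∪
        T.image (fun j => if i < j then (i, j) else (j, i)) := by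
      rintro ⟨a, b⟩ hab
      simp only [Finset.mem_filter, Finset.mem_product] at hab
      obtain ⟨⟨ha, hb⟩, hlt, heq⟩ := hab
      simp only [Finset.mem_union, Finset.mem_image, Finset.mem_filter, Finset.mem_product,
        Finset.mem_erase, hT]
      by_cases h1 : a = i
      · subst h1
        right
        exact ⟨b, ⟨⟨hlt.ne', hb⟩, by rw [norm_sub_rev]; exact heq⟩, by simp [hlt]⟩
      · by_cases h2 : b = i
        · subst h2
          right
          exact ⟨a, ⟨⟨h1, ha⟩, by rw [heq]; ring⟩, by simp [hlt.le]⟩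
        · left
          exact ⟨⟨⟨h1, ha⟩, ⟨h2, hb⟩⟩, hlt, heq⟩
    calc _ ≤ _ := Finset.card_le_card hsub
      _ ≤ _ := Finset.card_union_le _ _
      _ ≤ 5 * n + 5 := add_le_add hE (Finset.card_image_le.trans hTc)
      _ = _ := by ring

noncomputable abbrev isoC : ℂ ≃ₗᵢ[ℝ] EuclideanSpace ℝ (Fin 2) := Complex.orthonormalBasisOneI.repr

lemma mem_upper (n : ℕ) : 5 * n ∈ upperBounds {m : ℕ |
    ∃ (p : Fin n → EuclideanSpace ℝ (Fin 2)) (R : Fin n → ℝ),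
    (∀ i, 0 < R i) ∧
    Function.Injective (fun i => (p i, R i)) ∧
    (∀ i j, i ≠ j → 4 * R i * R j ≤ ‖p i - p j‖ ^ 2) ∧
    Set.ncard {q : Fin n × Fin n | q.1 < q.2 ∧
      ‖p q.1 - p q.2‖ ^ 2 = 4 * R q.1 * R q.2} = m} := by
  classical
  rintro m ⟨p, R, hR, -, hd, rfl⟩
  have hn : ∀ i j, ‖isoC.symm (p i) - isoC.symm (p j)‖ = ‖p i - p j‖ := by
    intro i j
    rw [← map_sub, LinearIsometryEquiv.norm_map]
  have := card_edges (fun i => isoC.symm (p i)) R hR (by simpa only [hn] using hd) n Finset.univ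
    (by simp)
  rw [← Set.ncard_coe_finset] at this
  simpa only [hn, Finset.univ_product_univ, Finset.coe_filter, Finset.mem_univ, true_and] using this

lemma max_le (n : ℕ) : maxTangencies n ≤ 5 * n := csSup_le' (mem_upper n)

lemma le_max {ι : Type*} [Fintype ι] (n : ℕ) (hn : Fintype.card ι = n)
    (z : ι → ℂ) (R : ι → ℝ) (hR : ∀ i, 0 < R i)
    (hd : ∀ i j, i ≠ j → 4 * R i * R j ≤ ‖z i - z j‖ ^ 2)
    (E : Finset (ι × ι)) (rk : ι → ℕ) (hrk : ∀ q ∈ E, rk q.1 < rk q.2)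
    (hE : ∀ q ∈ E, ‖z q.1 - z q.2‖ ^ 2 = 4 * R q.1 * R q.2) : E.card ≤ maxTangencies n := by
  classical
  let f : ι ≃ Fin n := Fintype.equivFinOfCardEq hn
  have hnm : ∀ i j, ‖isoC (z i) - isoC (z j)‖ = ‖z i - z j‖ := by
    intro i j
    rw [← map_sub, LinearIsometryEquiv.norm_map]
  have hmem := le_csSup (⟨_, mem_upper n⟩ : BddAbove _) (show _ ∈ _ from
    ⟨fun i => isoC (z (f.symm i)), fun i => R (f.symm i), fun i => hR _, ?_, ?_, rfl⟩)
  · refine le_trans ?_ hmem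
    rw [← Set.ncard_coe_finset]
    refine Set.ncard_le_ncard_of_injOn
      (fun q => if f q.1 < f q.2 then (f q.1, f q.2) else (f q.2, f q.1)) ?_ ?_ (Set.toFinite _)
    · rintro ⟨a, b⟩ hq
      have h1 := hE _ hq
      have h2 := hrk _ hq
      simp only [hnm, Set.mem_setOf_eq]
      simp only at h1 h2
      split_ifs with h
      · simpa using ⟨h, h1⟩
      · have hne : f b ≠ f a := by
          intro h'
          rw [f.injective h'] at h2
          exact lt_irrefl _ h2
        refine ⟨lt_of_le_of_ne (not_lt.1 h) hne, ?_⟩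
        simp only [Equiv.symm_apply_apply]
        rw [norm_sub_rev, h1]; ring
    · rintro ⟨a, b⟩ hq ⟨c, d⟩ hq' heq
      have h2 := hrk _ hq
      have h2' := hrk _ hq'
      simp only at heq h2 h2'
      split_ifs at heq <;> simp only [Prod.mk.injEq, EmbeddingLike.apply_eq_iff_eq] at heq <;>
        obtain ⟨h3, h4⟩ := heq <;> subst h3 <;> subst h4 <;> first | rfl | (exfalso; omega)
  · intro i j hij
    simp only [Prod.mk.injEq, EmbeddingLike.apply_eq_iff_eq] at hij
    by_contra hne
    have := hd (f.symm i) (f.symm j) (by simpa using hne)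
    rw [hij.1] at this
    simp at this
    nlinarith [mul_pos (hR (f.symm i)) (hR (f.symm j))]
  · intro i j hij
    rw [hnm]
    exact hd _ _ (by simpa using hij)

/-- The hexagonal lattice point (shifted away from the origin). -/
noncomputable def hex (a b : ℕ) : ℂ := ⟨(a + 1) + (b + 1) / 2, (b + 1) * (√3 / 2)⟩

lemma hex_sub (a b c d : ℕ) : ‖hex a b - hex c d‖ ^ 2 =
    (((a : ℤ) - c) ^ 2 + (a - c) * (b - d) + (b - d) ^ 2 : ℤ) := by
  have h3 : √3 ^ 2 = (3 : ℝ) := Real.sq_sqrt (by norm_num)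
  simp only [hex, ← Complex.normSq_eq_norm_sq, Complex.normSq_apply, Complex.sub_re, Complex.sub_im]
  push_cast
  ring_nf
  rw [h3]
  ring

lemma hex_norm_pos (a b : ℕ) : 0 < ‖hex a b‖ := by
  rw [norm_pos_iff]
  intro h
  have := congrArg Complex.re h
  simp only [hex, Complex.zero_re] at this
  have : (0 : ℝ) < (a + 1) + (b + 1) / 2 := by positivity
  linarith

lemma hex_sep (a b c d : ℕ) (h : (a, b) ≠ (c, d)) : 1 ≤ ‖hex a b - hex c d‖ ^ 2 := by
  rw [hex_sub]
  have : (1 : ℤ) ≤ (((a : ℤ) - c) ^ 2 + (a - c) * (b - d) + (b - d) ^ 2 : ℤ) := by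
    by_contra hlt
    push Not at hlt
    have h1 : ((a : ℤ) - c) = 0 := by
      by_contra h0
      have : 0 < ((a : ℤ) - c) ^ 2 := by positivity
      nlinarith [sq_nonneg (((a : ℤ) - c) + 2 * (b - d))]
    have h2 : ((b : ℤ) - d) = 0 := by
      rw [h1] at hlt
      by_contra h0
      have : 0 < ((b : ℤ) - d) ^ 2 := by positivity
      nlinarith
    apply h
    simp only [Prod.mk.injEq]
    omega
  exact_mod_cast this

noncomputable def zz (M : ℕ) : Option (Fin M × Fin M) → ℂ
  | none => 0
  | some (a, b) => (hex a b)⁻¹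

noncomputable def RR (M : ℕ) : Option (Fin M × Fin M) → ℝ
  | none => 1 / 2
  | some (a, b) => 1 / (2 * ‖hex a b‖ ^ 2)

def rk (M : ℕ) : Option (Fin M × Fin M) → ℕ
  | none => 3 * M
  | some (a, b) => 2 * a + b

lemma inv_sub_sq (u w : ℂ) (hu : 0 < ‖u‖) (hw : 0 < ‖w‖) :
    ‖u⁻¹ - w⁻¹‖ ^ 2 = ‖u - w‖ ^ 2 * (4 * (1 / (2 * ‖u‖ ^ 2)) * (1 / (2 * ‖w‖ ^ 2))) := by
  rw [inv_sub_inv (norm_pos_iff.1 hu) (norm_pos_iff.1 hw), norm_div, norm_mul, norm_sub_rev]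
  field_simp
  norm_num

def edge (N : ℕ) : (Fin N × Fin N) × Fin 4 →
    Option (Fin (N + 1) × Fin (N + 1)) × Option (Fin (N + 1) × Fin (N + 1))
  | ((a, b), 0) => (some (a.castSucc, b.castSucc), none)
  | ((a, b), 1) => (some (a.castSucc, b.castSucc), some (a.succ, b.castSucc))
  | ((a, b), 2) => (some (a.castSucc, b.castSucc), some (a.castSucc, b.succ))
  | ((a, b), 3) => (some (a.castSucc, b.succ), some (a.succ, b.castSucc))

lemma edge_inj (N : ℕ) : Function.Injective (edge N) := by
  rintro ⟨⟨a, b⟩, i⟩ ⟨⟨c, d⟩, j⟩ h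
  fin_cases i <;> fin_cases j <;> simp [edge, Fin.ext_iff] at h ⊢ <;> omega

lemma edge_rk (N : ℕ) (x) : rk (N + 1) (edge N x).1 < rk (N + 1) (edge N x).2 := by
  obtain ⟨⟨a, b⟩, i⟩ := x
  fin_cases i <;> simp [edge, rk] <;> omega

lemma edge_tan (N : ℕ) (x) : ‖zz (N + 1) (edge N x).1 - zz (N + 1) (edge N x).2‖ ^ 2 =
    4 * RR (N + 1) (edge N x).1 * RR (N + 1) (edge N x).2 := by
  obtain ⟨⟨a, b⟩, i⟩ := x
  fin_cases i
  · simp only [edge, zz, RR, Fin.zero_eta]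
    have := hex_norm_pos a b
    simp
    ring
  all_goals
    simp only [edge, zz, RR, Fin.mk_one, Fin.reduceFinMk]
    rw [inv_sub_sq _ _ (hex_norm_pos _ _) (hex_norm_pos _ _), hex_sub]
    simp

lemma lower (N : ℕ) : 4 * N ^ 2 ≤ maxTangencies ((N + 1) ^ 2 + 1) := by
  have := le_max ((N + 1) ^ 2 + 1) (by simp [sq]) (zz (N + 1)) (RR (N + 1)) ?_ ?_
    (Finset.univ.map ⟨edge N, edge_inj N⟩) (rk (N + 1)) ?_ ?_
  · refine le_trans (le_of_eq ?_) this
    simp [sq]; ring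
  · rintro (_ | ⟨a, b⟩)
    · simp [RR]
    · have := hex_norm_pos a b
      simp only [RR]; positivity
  · rintro (_ | ⟨a, b⟩) (_ | ⟨c, d⟩) hne
    · simp at hne
    · simp [zz, RR]; ring_nf; rfl
    · simp [zz, RR]; ring_nf; rfl
    · have h1 := hex_norm_pos a b
      have h2 := hex_norm_pos c d
      simp only [zz, RR]
      rw [inv_sub_sq _ _ h1 h2]
      apply le_mul_of_one_le_left (by positivity)
      apply hex_sep
      intro h
      apply hne
      simp only [Prod.mk.injEq] at h
      simp [Fin.ext_iff, h.1, h.2]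
  · intro q hq
    simp only [Finset.mem_map, Finset.mem_univ, true_and, Function.Embedding.coeFn_mk] at hq
    obtain ⟨x, rfl⟩ := hq
    exact edge_rk N x
  · intro q hq
    simp only [Finset.mem_map, Finset.mem_univ, true_and, Function.Embedding.coeFn_mk] at hq
    obtain ⟨x, rfl⟩ := hq
    exact edge_tan N x

lemma ratio_le (n : ℕ) : (maxTangencies n : ℝ) / (n : ℝ) ≤ 5 := by
  apply div_le_of_le_mul₀ (by positivity) (by norm_num)
  exact_mod_cast max_le n

end HoroPack

/-- `limsup_{n → ∞} m_max(n)/n` lies in the interval `[4, 5]`. -/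
theorem limsup_maxTangencies_div_mem_Icc :
    4 ≤ Filter.limsup (fun n : ℕ => (maxTangencies n : ℝ) / (n : ℝ)) Filter.atTop ∧
    Filter.limsup (fun n : ℕ => (maxTangencies n : ℝ) / (n : ℝ)) Filter.atTop ≤ 5 := by
  constructor
  · apply le_of_forall_lt
    intro c hc
    obtain ⟨c', hc1, hc2⟩ := exists_between hc
    refine hc1.trans_le ?_
    apply Filter.le_limsup_of_frequently_le
    · rw [Filter.frequently_atTop]
      intro k
      obtain ⟨N, hN⟩ := exists_nat_gt (max (k : ℝ) (16 / (4 - c')))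
      have hk : (k : ℝ) < N := (le_max_left _ _).trans_lt hN
      have hk' : k < N := by exact_mod_cast hk
      have hN2 : 16 / (4 - c') < N := (le_max_right _ _).trans_lt hN
      rw [div_lt_iff₀ (by linarith)] at hN2
      refine ⟨(N + 1) ^ 2 + 1, by nlinarith, ?_⟩
      rw [le_div_iff₀ (by positivity)]
      have h1 : (4 * N ^ 2 : ℝ) ≤ maxTangencies ((N + 1) ^ 2 + 1) := by
        exact_mod_cast HoroPack.lower N
      refine le_trans ?_ h1
      push_cast
      have h2 : (1 : ℝ) ≤ N := by
        have : 1 ≤ N := by omega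
        exact_mod_cast this
      have h3 : 0 < 4 - c' := by linarith
      nlinarith [mul_lt_mul_of_pos_right hN2 (by linarith : (0 : ℝ) < N)]
    · exact ⟨5, by simpa using ⟨0, fun n _ => HoroPack.ratio_le n⟩⟩
  · apply Filter.limsup_le_of_le
    · exact ⟨0, fun a ha => by
        obtain ⟨n, hn⟩ := (Filter.eventually_map.1 ha).exists
        exact le_trans (by positivity) hn⟩
    · exact Filter.Eventually.of_forall HoroPack.ratio_le
end
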